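/- For every real Δ > 0 and all real δ, y, writing s = 1/2 + δ + iy with s ∉ {0,1}, the real and imaginary parts of F(s,Δ) are given by: Re F(s,Δ) = −[ (1+2δ)/((1+2δ)² + 4y²) + (1−2δ)/((1−2δ)² + 4y²) ] + ∫₀¹ t^{−1/2} cos(y ln t) cosh(δ ln t) (θ₃(e^{−πtΔ}) θ₃(e^{−πt/Δ}) − 1/t) dt, and Im F(s,Δ) = 2y[ 1/((1+2δ)² + 4y²) − 1/((1−2δ)² + 4y²) ] + ∫₀¹ t^{−1/2} sin(y ln t) sinh(δ ln t) (θ₃(e^{−πtΔ}) θ₃(e^{−πt/Δ}) − 1/t) dt. -/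

import Mathlib

open MeasureTheory

/-- The Jacobi theta function `θ₃(q) = Σ_{j∈ℤ} q^{j²}`. -/
noncomputable def theta3 (q : ℝ) : ℝ := ∑' j : ℤ, q ^ (j ^ 2)

/-- The two-dimensional Epstein zeta function on the rectangular lattice with
spacings `1` and `Δ`:  `ζ⁽²⁾(s,Δ) = (1/2) Σ'_{(j,k)≠(0,0)} (j² + Δ²k²)^(-s)`. -/
noncomputable def epsteinZeta2 (s : ℂ) (Δ : ℝ) : ℂ :=
  (1 / 2) * ∑' p : {p : ℤ × ℤ // p ≠ 0},
    (((p.1.1 : ℝ) ^ 2 + Δ ^ 2 * (p.1.2 : ℝ) ^ 2 : ℝ) : ℂ) ^ (-s)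

/-- The analytic continuation
`F(s,Δ) = -(1/2)(1/(1-s) + 1/s)
   + (1/2)∫₀¹ (t^{s-1} + t^{-s}) (θ₃(e^{-πtΔ}) θ₃(e^{-πt/Δ}) - 1/t) dt`. -/
noncomputable def F (s : ℂ) (Δ : ℝ) : ℂ :=
  -(1 / 2) * (1 / (1 - s) + 1 / s) +
    (1 / 2) * ∫ t in Set.Ioo (0 : ℝ) 1,
      ((t : ℂ) ^ (s - 1) + (t : ℂ) ^ (-s)) *
        ((theta3 (Real.exp (-(Real.pi * t * Δ))) *
            theta3 (Real.exp (-(Real.pi * t / Δ))) - 1 / t : ℝ) : ℂ)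

open Filter Asymptotics Topology HurwitzZeta

lemma theta3_exp_neg_pi_mul {x : ℝ} (hx : 0 < x) :
    theta3 (Real.exp (-(Real.pi * x))) = evenKernel 0 x := by
  have h := (hasSum_int_evenKernel 0 hx).tsum_eq
  rw [QuotientAddGroup.mk_zero] at h
  rw [← h, theta3]
  refine tsum_congr fun j => ?_
  rw [← Real.rpow_intCast, ← Real.exp_mul]
  push_cast
  ring_nf

lemma evenKernel_zero_sub_one_isBigO_rpow (r : ℝ) :
    (fun x => evenKernel 0 x - 1) =O[atTop] (fun x : ℝ => x ^ r) := by
  obtain ⟨p, hp, h⟩ := isBigO_atTop_evenKernel_sub 0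
  simpa using h.trans (isLittleO_exp_neg_mul_rpow_atTop hp r).isBigO

lemma evenKernel_zero_const_div_sub_one_isBigO_rpow {c : ℝ} (hc : 0 < c) (r : ℝ) :
    (fun t => evenKernel 0 (c / t) - 1) =O[𝓝[>] 0] (fun t : ℝ => t ^ r) := by
  have hlim : Tendsto (fun t : ℝ => c / t) (𝓝[>] 0) atTop := by
    simpa [div_eq_mul_inv] using tendsto_inv_nhdsGT_zero.const_mul_atTop hc
  refine ((evenKernel_zero_sub_one_isBigO_rpow (-r)).comp_tendsto hlim).trans ?_
  refine IsBigO.of_bound (c ^ (-r)) ?_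
  filter_upwards [self_mem_nhdsWithin] with t ht
  have ht : 0 < t := ht
  simp only [Function.comp_apply]
  rw [Real.div_rpow hc.le ht.le, Real.rpow_neg ht.le, div_inv_eq_mul, norm_mul,
    Real.norm_of_nonneg (Real.rpow_nonneg hc.le _)]

lemma evenKernel_zero_mul_sub_inv {Δ t : ℝ} (hΔ : 0 < Δ) (ht : 0 < t) :
    evenKernel 0 (t * Δ) * evenKernel 0 (t / Δ) - 1 / t =
      t⁻¹ * (evenKernel 0 (Δ⁻¹ / t) * evenKernel 0 (Δ / t) - 1) := by
  rw [evenKernel_functional_equation 0 (t * Δ), evenKernel_functional_equation 0 (t / Δ),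
    ← evenKernel_eq_cosKernel_of_zero]
  have h : (t * Δ) ^ (1 / 2 : ℝ) * (t / Δ) ^ (1 / 2 : ℝ) = t := by
    rw [← Real.mul_rpow (by positivity) (by positivity),
      show t * Δ * (t / Δ) = t ^ 2 by field_simp, ← Real.sqrt_eq_rpow, Real.sqrt_sq ht.le]
  have e1 : 1 / (t * Δ) = Δ⁻¹ / t := by field_simp
  have e2 : 1 / (t / Δ) = Δ / t := by field_simp
  rw [e1, e2, mul_mul_mul_comm, div_mul_div_comm, h]
  ring

lemma evenKernel_zero_mul_sub_inv_isBigO_rpow {Δ : ℝ} (hΔ : 0 < Δ) (r : ℝ) :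
    (fun t => evenKernel 0 (t * Δ) * evenKernel 0 (t / Δ) - 1 / t)
      =O[𝓝[>] 0] (fun t : ℝ => t ^ r) := by
  have h1 := evenKernel_zero_const_div_sub_one_isBigO_rpow (inv_pos.2 hΔ) (r + 1)
  have h2 := evenKernel_zero_const_div_sub_one_isBigO_rpow hΔ (r + 1)
  have h2' : (fun t => evenKernel 0 (Δ / t)) =O[𝓝[>] 0] (fun _ : ℝ => (1 : ℝ)) := by
    have h := evenKernel_zero_const_div_sub_one_isBigO_rpow hΔ 0
    simp only [Real.rpow_zero] at h
    simpa using h.add (isBigO_refl (fun _ : ℝ => (1 : ℝ)) _)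
  have h3 := (h1.mul h2').add (by simpa using h2)
  refine ((isBigO_refl (fun t : ℝ => t⁻¹) (𝓝[>] 0)).mul h3).congr' ?_ ?_
  · filter_upwards [self_mem_nhdsWithin] with t ht
    rw [evenKernel_zero_mul_sub_inv hΔ ht]
    ring
  · filter_upwards [self_mem_nhdsWithin] with t ht
    have ht : 0 < t := ht
    rw [Real.rpow_add_one ht.ne']
    field_simp

lemma integrableOn_cpow_mul_theta3_mul_sub_inv {Δ : ℝ} (hΔ : 0 < Δ) (s : ℂ) :
    IntegrableOn (fun t : ℝ => (t : ℂ) ^ s *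
      ((theta3 (Real.exp (-(Real.pi * t * Δ))) *
        theta3 (Real.exp (-(Real.pi * t / Δ))) - 1 / t : ℝ) : ℂ)) (Set.Ioo 0 1) := by
  set g : ℝ → ℝ := fun t => evenKernel 0 (t * Δ) * evenKernel 0 (t / Δ) - 1 / t with hg
  set f : ℝ → ℂ := (Set.Ioo (0 : ℝ) 1).indicator fun t => (g t : ℂ) with hf
  have hcont : ContinuousOn (fun t => (g t : ℂ)) (Set.Ioi 0) := by
    refine Complex.continuous_ofReal.comp_continuousOn ?_
    refine ContinuousOn.sub (ContinuousOn.mul ?_ ?_) ?_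
    · exact (continuousOn_evenKernel 0).comp (by fun_prop) fun t ht => mul_pos ht hΔ
    · exact (continuousOn_evenKernel 0).comp (by fun_prop) fun t ht => div_pos ht hΔ
    · exact continuousOn_const.div continuousOn_id fun t ht => (ne_of_gt ht)
  have hloc : LocallyIntegrableOn f (Set.Ioi 0) := fun x hx => by
    obtain ⟨U, hU, h⟩ := hcont.locallyIntegrableOn (μ := volume) measurableSet_Ioi x hx
    exact ⟨U, hU, h.indicator measurableSet_Ioo⟩
  have htop : f =O[atTop] (fun t : ℝ => t ^ (-(s.re + 2))) := by
    refine EventuallyEq.trans_isBigO (f₂ := fun _ => (0 : ℂ)) ?_ (isBigO_zero _ _)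
    filter_upwards [eventually_ge_atTop 1] with t ht
    exact Set.indicator_of_notMem (fun h => h.2.not_ge ht) _
  have hbot : f =O[𝓝[>] 0] (fun t : ℝ => t ^ (-s.re)) := by
    refine IsBigO.trans (IsBigO.of_bound 1 (Eventually.of_forall fun t => ?_))
      (evenKernel_zero_mul_sub_inv_isBigO_rpow hΔ (-s.re))
    rw [one_mul, ← Complex.norm_real]
    exact norm_indicator_le_norm_self _ _
  have hmellin : MellinConvergent f (s + 1) :=
    mellinConvergent_of_isBigO_rpow hloc htop (by simp) hbot (by simp)
  refine (IntegrableOn.mono_set hmellin Set.Ioo_subset_Ioi_self).congr_fun ?_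
    measurableSet_Ioo
  intro t ht
  simp only [hf, hg, Set.indicator_of_mem ht, add_sub_cancel_right, smul_eq_mul]
  rw [mul_assoc Real.pi, mul_div_assoc Real.pi, theta3_exp_neg_pi_mul (mul_pos ht.1 hΔ),
    theta3_exp_neg_pi_mul (div_pos ht.1 hΔ)]

lemma cpow_add_cpow_reflect {t : ℝ} (ht : 0 < t) (δ y : ℝ) :
    (t : ℂ) ^ ((1 / 2 + (δ : ℂ) + y * Complex.I) - 1) +
        (t : ℂ) ^ (-(1 / 2 + (δ : ℂ) + y * Complex.I)) =
      2 * ((t ^ (-(1 / 2) : ℝ) * Real.cos (y * Real.log t) * Real.cosh (δ * Real.log t) : ℝ) +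
        (t ^ (-(1 / 2) : ℝ) * Real.sin (y * Real.log t) * Real.sinh (δ * Real.log t) : ℝ) *
          Complex.I) := by
  have ht' : (t : ℂ) ≠ 0 := Complex.ofReal_ne_zero.2 ht.ne'
  rw [show (1 / 2 + (δ : ℂ) + y * Complex.I) - 1 =
      ((-(1 / 2) : ℝ) : ℂ) + (δ + y * Complex.I) by push_cast; ring,
    show -(1 / 2 + (δ : ℂ) + y * Complex.I) =
      ((-(1 / 2) : ℝ) : ℂ) + -(δ + y * Complex.I) by push_cast; ring,
    Complex.cpow_add _ (δ + y * Complex.I) ht', Complex.cpow_add _ (-(δ + y * Complex.I)) ht',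
    ← Complex.ofReal_cpow ht.le,
    Complex.cpow_def_of_ne_zero ht', Complex.cpow_def_of_ne_zero ht', ← Complex.ofReal_log ht.le,
    mul_neg, ← mul_add, ← Complex.two_cosh,
    show (Real.log t : ℂ) * (δ + y * Complex.I) =
      δ * Real.log t + (y * Real.log t) * Complex.I by ring,
    Complex.cosh_add, Complex.cosh_mul_I, Complex.sinh_mul_I]
  push_cast
  ring

lemma normSq_half_add (a y : ℝ) :
    Complex.normSq (1 / 2 + (a : ℂ) + y * Complex.I) = ((1 + 2 * a) ^ 2 + 4 * y ^ 2) / 4 := by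
  simp [Complex.normSq_apply]
  ring

lemma one_div_half_add (a y : ℝ) :
    1 / (1 / 2 + (a : ℂ) + y * Complex.I) =
      ((2 * (1 + 2 * a) / ((1 + 2 * a) ^ 2 + 4 * y ^ 2) : ℝ) : ℂ) -
        ((4 * y / ((1 + 2 * a) ^ 2 + 4 * y ^ 2) : ℝ) : ℂ) * Complex.I := by
  rw [one_div]
  apply Complex.ext
  · rw [Complex.inv_re, normSq_half_add, div_div_eq_mul_div]
    simp only [Complex.sub_re, Complex.ofReal_re, Complex.re_ofReal_mul, Complex.I_re, mul_zero,
      sub_zero]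
    simp
    ring
  · rw [Complex.inv_im, normSq_half_add, div_div_eq_mul_div]
    simp only [Complex.sub_im, Complex.ofReal_im, Complex.im_ofReal_mul, Complex.I_im, mul_one,
      zero_sub]
    simp
    ring

lemma F_half_add (Δ : ℝ) (hΔ : 0 < Δ) (δ y : ℝ) :
    F (1 / 2 + (δ : ℂ) + y * Complex.I) Δ =
      -(1 / 2) * (1 / (1 / 2 + ((-δ : ℝ) : ℂ) + ((-y : ℝ) : ℂ) * Complex.I) +
        1 / (1 / 2 + (δ : ℂ) + y * Complex.I)) +
      (((∫ t in Set.Ioo (0 : ℝ) 1,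
          t ^ (-(1 / 2) : ℝ) * Real.cos (y * Real.log t) * Real.cosh (δ * Real.log t) *
            (theta3 (Real.exp (-(Real.pi * t * Δ))) *
              theta3 (Real.exp (-(Real.pi * t / Δ))) - 1 / t) : ℝ) : ℂ) +
        ((∫ t in Set.Ioo (0 : ℝ) 1,
          t ^ (-(1 / 2) : ℝ) * Real.sin (y * Real.log t) * Real.sinh (δ * Real.log t) *
            (theta3 (Real.exp (-(Real.pi * t * Δ))) *
              theta3 (Real.exp (-(Real.pi * t / Δ))) - 1 / t) : ℝ) : ℂ) * Complex.I) := by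
  set s : ℂ := 1 / 2 + (δ : ℂ) + y * Complex.I with hs
  have hint := ((integrableOn_cpow_mul_theta3_mul_sub_inv hΔ (s - 1)).add
    (integrableOn_cpow_mul_theta3_mul_sub_inv hΔ (-s))).const_mul (1 / 2)
  have hre := integral_re hint
  have him := integral_im hint
  have key : ∀ t ∈ Set.Ioo (0 : ℝ) 1, ∀ g : ℝ,
      (1 / 2 : ℂ) * ((t : ℂ) ^ (s - 1) * (g : ℂ) + (t : ℂ) ^ (-s) * (g : ℂ)) =
        ((t ^ (-(1 / 2) : ℝ) * Real.cos (y * Real.log t) * Real.cosh (δ * Real.log t) * g : ℝ) +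
        (t ^ (-(1 / 2) : ℝ) * Real.sin (y * Real.log t) * Real.sinh (δ * Real.log t) * g : ℝ) *
          Complex.I) := fun t ht g => by
    rw [← add_mul, hs, cpow_add_cpow_reflect ht.1]
    push_cast
    ring
  rw [F, show (1 : ℂ) - s = 1 / 2 + ((-δ : ℝ) : ℂ) + ((-y : ℝ) : ℂ) * Complex.I by
    rw [hs]; push_cast; ring, ← integral_const_mul]
  congr 1
  simp only [add_mul]
  refine Complex.ext ?_ ?_
  · refine hre.symm.trans ?_
    simp only [Complex.add_re, Complex.ofReal_re, Complex.re_ofReal_mul, Complex.I_re, mul_zero,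
      add_zero]
    refine setIntegral_congr_fun measurableSet_Ioo fun t ht => ?_
    simp only [Pi.add_apply]
    rw [key t ht]
    simp only [RCLike.re_eq_complex_re, Complex.add_re, Complex.ofReal_re, Complex.re_ofReal_mul,
      Complex.I_re, mul_zero, add_zero]
  · refine him.symm.trans ?_
    simp only [Complex.add_im, Complex.ofReal_im, Complex.im_ofReal_mul, Complex.I_im, mul_one,
      zero_add]
    refine setIntegral_congr_fun measurableSet_Ioo fun t ht => ?_
    simp only [Pi.add_apply]
    rw [key t ht]
    simp only [RCLike.im_eq_complex_im, Complex.add_im, Complex.ofReal_im, Complex.im_ofReal_mul,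
      Complex.I_im, mul_one, zero_add]

/-- for `Δ > 0` and real `δ`, `y`, writing `s = 1/2 + δ + iy` with
`s ∉ {0,1}`, the real and imaginary parts of `F(s,Δ)` are given by the stated
cosh/sinh integral formulas. -/
theorem F_re_im_formulas (Δ : ℝ) (hΔ : 0 < Δ) (δ y : ℝ)
    (h0 : (1 / 2 + (δ : ℂ) + y * Complex.I) ≠ 0)
    (h1 : (1 / 2 + (δ : ℂ) + y * Complex.I) ≠ 1) :
    (F (1 / 2 + (δ : ℂ) + y * Complex.I) Δ).re =
      -((1 + 2 * δ) / ((1 + 2 * δ) ^ 2 + 4 * y ^ 2) +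
          (1 - 2 * δ) / ((1 - 2 * δ) ^ 2 + 4 * y ^ 2)) +
        ∫ t in Set.Ioo (0 : ℝ) 1,
          t ^ (-(1 / 2) : ℝ) * Real.cos (y * Real.log t) * Real.cosh (δ * Real.log t) *
            (theta3 (Real.exp (-(Real.pi * t * Δ))) *
              theta3 (Real.exp (-(Real.pi * t / Δ))) - 1 / t) ∧
    (F (1 / 2 + (δ : ℂ) + y * Complex.I) Δ).im =
      2 * y * (1 / ((1 + 2 * δ) ^ 2 + 4 * y ^ 2) -
          1 / ((1 - 2 * δ) ^ 2 + 4 * y ^ 2)) +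
        ∫ t in Set.Ioo (0 : ℝ) 1,
          t ^ (-(1 / 2) : ℝ) * Real.sin (y * Real.log t) * Real.sinh (δ * Real.log t) *
            (theta3 (Real.exp (-(Real.pi * t * Δ))) *
              theta3 (Real.exp (-(Real.pi * t / Δ))) - 1 / t) := by
  rw [F_half_add Δ hΔ, one_div_half_add, one_div_half_add]
  have e : (1 + 2 * -δ) = 1 - 2 * δ := by ring
  rw [e, neg_sq]
  have hc : (-(1 / 2) : ℂ) = ((-(1 / 2) : ℝ) : ℂ) := by push_cast; rfl
  rw [hc]
  constructor
  · simp only [Complex.add_re, Complex.sub_re, Complex.re_ofReal_mul, Complex.ofReal_re,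
      Complex.I_re, mul_zero, add_zero, sub_zero]
    ring
  · simp only [Complex.add_im, Complex.sub_im, Complex.im_ofReal_mul, Complex.ofReal_im,
      Complex.I_im, mul_one, zero_add, zero_sub]
    ring
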